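/- Let f be an area-preserving homeomorphism of the closed annulus 𝔸 = (ℝ/ℤ)×[-1,1] admitting a lift, and assume f is NICIS. Then f admits a dense orbit: there exists a point z ∈ Int𝔸 such that the full orbit { fⁿ(z) : n ∈ ℤ } is dense in 𝔸. -/

import Mathlib

open MeasureTheory Set

attribute [local instance] MeasureTheory.Measure.Subtype.measureSpace

noncomputable section

/-- The closed annulus `𝔸 = (ℝ/ℤ) × [-1,1]`. -/
abbrev Annulus := AddCircle (1 : ℝ) × (Set.Icc (-1 : ℝ) 1)

/-- The universal cover `ℝ × [-1,1]` of the closed annulus. -/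
abbrev AnnulusCover := ℝ × (Set.Icc (-1 : ℝ) 1)

/-- The covering projection `ℝ × [-1,1] → (ℝ/ℤ) × [-1,1]`. -/
def annulusProj (z : AnnulusCover) : Annulus := ((z.1 : AddCircle (1 : ℝ)), z.2)

/-- The interior `(ℝ/ℤ) × (-1,1)` of the closed annulus. -/
def annulusInt : Set Annulus := {z | -1 < (z.2 : ℝ) ∧ (z.2 : ℝ) < 1}

/-- The upper boundary circle `(ℝ/ℤ) × {1}`. -/
def annulusBdryPlus : Set Annulus := {z | (z.2 : ℝ) = 1}

/-- `ft` is a lift of the homeomorphism `f` of the annulus: it commutes with the deck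
transformation `(x,y) ↦ (x+1,y)` and descends to `f`. -/
def IsLift (f : Annulus ≃ₜ Annulus) (ft : AnnulusCover ≃ₜ AnnulusCover) : Prop :=
  (∀ z : AnnulusCover, ft (z.1 + 1, z.2) = ((ft z).1 + 1, (ft z).2)) ∧
  (∀ z : AnnulusCover, f (annulusProj z) = annulusProj (ft z))

/-- `f` admits no nonempty compact invariant set contained in the interior of the annulus. -/
def NICIS (f : Annulus ≃ₜ Annulus) : Prop :=
  ¬ ∃ K : Set Annulus, K.Nonempty ∧ IsCompact K ∧ f '' K = K ∧ K ⊆ annulusInt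

theorem exists_continuous_log {X : Type*} [TopologicalSpace X] [ContractibleSpace X] {F : X → ℂ}
    (hF : Continuous F) (h0 : ∀ x, F x ≠ 0) :
    ∃ G : X → ℂ, Continuous G ∧ ∀ x, Complex.exp (G x) = F x := by
  obtain ⟨x₀, ⟨H⟩⟩ := id_nullhomotopic X
  let F' : C(X, {z : ℂ // z ≠ 0}) := ⟨fun x => ⟨F x, h0 x⟩, by fun_prop⟩
  let K : C(unitInterval × X, {z : ℂ // z ≠ 0}) := F'.comp H.symm.toContinuousMap
  let g : C(X, ℂ) := .const X (Complex.log (F x₀))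
  have hK : ∀ a, K (0, a) = (fun z : ℂ => (⟨_, z.exp_ne_zero⟩ : {z : ℂ // z ≠ 0})) (g a) := by
    intro a
    apply Subtype.ext
    have : H.symm (0, a) = x₀ := by rw [ContinuousMap.Homotopy.apply_zero]; rfl
    simp [K, g, F', this, Complex.exp_log (h0 x₀)]
  refine ⟨fun x => Complex.isCoveringMap_exp.liftHomotopy K g hK (1, x), by fun_prop, fun x => ?_⟩
  have h1 := congr_fun (Complex.isCoveringMap_exp.liftHomotopy_lifts K g hK) (1, x)
  have h2 : H.symm (1, x) = x := by rw [ContinuousMap.Homotopy.apply_one]; rfl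
  have h3 := congr_arg Subtype.val h1
  simpa [K, F', h2] using h3

theorem continuous_log_unique {X : Type*} [TopologicalSpace X] [PreconnectedSpace X] {G H : X → ℂ}
    (hG : Continuous G) (hH : Continuous H) (h : ∀ x, Complex.exp (G x) = Complex.exp (H x)) :
    ∃ n : ℤ, ∀ x, G x = H x + n * (2 * Real.pi * Complex.I) := by
  choose n hn using fun x => Complex.exp_eq_exp_iff_exists_int.1 (h x)
  have hc : Continuous n := by
    rw [Int.isClosedEmbedding_coe_real.isInducing.continuous_iff]
    have : ((↑) : ℤ → ℝ) ∘ n = fun x => ((G x - H x) / (2 * Real.pi * Complex.I)).re := by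
      funext x
      rw [hn x]
      simp
    rw [this]
    fun_prop
  rcases isEmpty_or_nonempty X with hX | ⟨⟨x₀⟩⟩
  · exact ⟨0, fun x => (hX.false x).elim⟩
  · exact ⟨n x₀, fun x => by rw [hn x, PreconnectedSpace.constant ‹_› hc (x := x) (y := x₀)]⟩

theorem log_increment_shift {H : ℂ × ℂ → ℂ} {d : ℤ}
    (hd : ∀ z w, H (z, w + 2 * Real.pi * Complex.I)
      = H (z, w) + d * (2 * Real.pi * Complex.I)) (j : ℤ) (z w : ℂ) :
    H (z, w + j * (2 * Real.pi * Complex.I))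
      = H (z, w) + j * (d * (2 * Real.pi * Complex.I)) := by
  induction j using Int.induction_on with
  | zero => simp
  | succ i ih =>
    have := hd z (w + i * (2 * Real.pi * Complex.I))
    push_cast at ih ⊢
    rw [add_mul, one_mul, ← add_assoc, this, ih]
    ring
  | pred i ih =>
    have := hd z (w + (-i - 1) * (2 * Real.pi * Complex.I))
    push_cast at ih ⊢
    rw [show w + (-i - 1) * (2 * Real.pi * Complex.I) + 2 * Real.pi * Complex.I
      = w + -i * (2 * Real.pi * Complex.I) by ring, ih] at this
    linear_combination -this

/-- The increments of the square of a homeomorphism of the plane have a continuous logarithm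
of monodromy `1`. -/
theorem exists_log_increment_sq (h : ℂ ≃ₜ ℂ) :
    ∃ H : ℂ × ℂ → ℂ, Continuous H ∧
      (∀ z w, Complex.exp (H (z, w)) = h (h (z + Complex.exp w)) - h (h z)) ∧
      ∀ z w, H (z, w + 2 * Real.pi * Complex.I) = H (z, w) + 2 * Real.pi * Complex.I := by
  have key : ∀ h : ℂ ≃ₜ ℂ, ∃ H : ℂ × ℂ → ℂ, Continuous H ∧
      (∀ z w, Complex.exp (H (z, w)) = h (z + Complex.exp w) - h z) ∧
      ∃ d : ℤ, ∀ z w, H (z, w + 2 * Real.pi * Complex.I)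
        = H (z, w) + d * (2 * Real.pi * Complex.I) := by
    intro h
    obtain ⟨H, hH, hexp⟩ := exists_continuous_log
      (F := fun p : ℂ × ℂ => h (p.1 + Complex.exp p.2) - h p.1) (by fun_prop) (by
        intro p
        rw [sub_ne_zero]
        exact fun h1 => Complex.exp_ne_zero p.2 (by simpa using h.injective h1))
    obtain ⟨d, hd⟩ := continuous_log_unique
      (G := fun p : ℂ × ℂ => H (p.1, p.2 + 2 * Real.pi * Complex.I)) (H := H)
      (by fun_prop) hH (by intro p; simp [hexp, Complex.exp_periodic p.2])
    exact ⟨H, hH, fun z w => hexp (z, w), d, fun z w => hd (z, w)⟩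
  obtain ⟨H₁, c₁, e₁, d₁, s₁⟩ := key h
  obtain ⟨H₂, c₂, e₂, d₂, s₂⟩ := key h.symm
  obtain ⟨n, hn⟩ := continuous_log_unique (G := fun p : ℂ × ℂ => H₂ (h p.1, H₁ p))
    (H := fun p => p.2) (by fun_prop) (by fun_prop) (by
      rintro ⟨z, w⟩
      simp [e₂, e₁])
  have hdd : d₁ * d₂ = 1 := by
    have h1 := hn (0, 0 + 2 * Real.pi * Complex.I)
    have h2 := hn (0, 0)
    simp only [s₁ 0 0, log_increment_shift s₂] at h1 h2
    have h3 : ((d₁ * d₂ : ℤ) : ℂ) * (2 * Real.pi * Complex.I)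
        = (1 : ℤ) * (2 * Real.pi * Complex.I) := by
      push_cast
      linear_combination h1 - h2
    exact_mod_cast mul_right_cancel₀ Complex.two_pi_I_ne_zero h3
  have hsq : d₁ * d₁ = 1 := by
    rcases Int.eq_one_or_neg_one_of_mul_eq_one hdd with h | h <;> simp [h]
  refine ⟨fun p => H₁ (h p.1, H₁ p), by fun_prop, fun z w => ?_, fun z w => ?_⟩
  · simp [e₁]
  · have hsq' : (d₁ : ℂ) * d₁ = 1 := by exact_mod_cast hsq
    simp only [s₁ z w, log_increment_shift s₁]
    linear_combination (2 * Real.pi * Complex.I) * hsq'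

theorem log_increment_symm {k : ℂ → ℂ} {H : ℂ × ℂ → ℂ} (hH : Continuous H)
    (hexp : ∀ z w, Complex.exp (H (z, w)) = k (z + Complex.exp w) - k z)
    (hper : ∀ z w, H (z, w + 2 * Real.pi * Complex.I) = H (z, w) + 2 * Real.pi * Complex.I)
    (z w : ℂ) :
    H (z + Complex.exp w, w + Real.pi * Complex.I) = H (z, w) + Real.pi * Complex.I := by
  have hneg : ∀ w : ℂ, Complex.exp (w + Real.pi * Complex.I) = -Complex.exp w := by
    intro w; rw [Complex.exp_add, Complex.exp_pi_mul_I]; ring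
  obtain ⟨n, hn⟩ := continuous_log_unique
    (G := fun p : ℂ × ℂ => H (p.1 + Complex.exp p.2, p.2 + Real.pi * Complex.I))
    (H := fun p => H p + Real.pi * Complex.I) (by fun_prop) (by fun_prop) (by
      rintro ⟨z, w⟩
      simp only [hneg, hexp]
      simp)
  have h1 := hn (z, w)
  have h2 := hn (z + Complex.exp w, w + Real.pi * Complex.I)
  simp only [hneg] at h1 h2
  rw [show w + Real.pi * Complex.I + Real.pi * Complex.I = w + 2 * Real.pi * Complex.I by ring,
    add_neg_cancel_right, hper] at h2
  have h3 : (n : ℂ) * (2 * Real.pi * Complex.I) = 0 := by linear_combination (h2 + h1) / (-2)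
  rw [h1, h3, add_zero]

/-- A fixed point free square of a homeomorphism has no periodic translation path. -/
theorem no_closing_translation_path (h : ℂ ≃ₜ ℂ) (hfix : ∀ z, h (h z) ≠ z) {Γ : ℝ → ℂ}
    (hΓ : Continuous Γ) (hk : ∀ s, h (h (Γ s)) = Γ (s + 1)) {x y : ℝ} (hxy : y + 1 ≤ x)
    (hne : ∀ s t, y ≤ s → s + 1 ≤ t → t ≤ x → Γ s ≠ Γ t) (hclose : Γ (x + 1) = Γ y) : False := by
  obtain ⟨H₀, hH₀, hexp₀, hper₀⟩ := exists_log_increment_sq h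
  obtain ⟨θ, hθ, hθe⟩ := exists_continuous_log (F := fun z => h (h z) - z) (by fun_prop)
    (fun z => sub_ne_zero.2 (hfix z))
  obtain ⟨H, hH, hexp, hper, hHθ⟩ : ∃ H : ℂ × ℂ → ℂ, Continuous H ∧
      (∀ z w, Complex.exp (H (z, w)) = h (h (z + Complex.exp w)) - h (h z)) ∧
      (∀ z w, H (z, w + 2 * Real.pi * Complex.I) = H (z, w) + 2 * Real.pi * Complex.I) ∧
      ∀ z, H (z, θ z) = θ (h (h z)) := by
    obtain ⟨m, hm⟩ := continuous_log_unique (G := fun z => H₀ (z, θ z))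
      (H := fun z => θ (h (h z))) (by fun_prop) (by fun_prop) (by
        intro z; simp [hexp₀, hθe])
    refine ⟨fun p => H₀ p - m * (2 * Real.pi * Complex.I), by fun_prop, fun z w => ?_,
      fun z w => ?_, fun z => ?_⟩
    · rw [Complex.exp_sub, hexp₀, Complex.exp_int_mul_two_pi_mul_I, div_one]
    · simp only [hper₀]; ring
    · simp only [hm]; ring
  let c : ℝ → ℝ := fun s => max y (min (x - 1) s)
  have hc : Continuous c := by fun_prop
  have hc1 : ∀ s, y ≤ c s := fun s => le_max_left _ _
  have hc2 : ∀ s, c s ≤ x - 1 := fun s => max_le (by linarith) (min_le_left _ _)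
  have hcs : ∀ s, y ≤ s → s ≤ x - 1 → c s = s := fun s h1 h2 => by simp [c, h1, h2]
  obtain ⟨Ψ₀, hΨ₀, hΨ₀e⟩ := exists_continuous_log
    (F := fun p : ℝ × ℝ => Γ (max (c p.1 + 1) (min x p.2)) - Γ (c p.1)) (by fun_prop) (by
      intro p
      refine sub_ne_zero.2 (hne _ _ (hc1 _) (le_max_left _ _) (max_le ?_ (min_le_left _ _))).symm
      linarith [hc2 p.1])
  have hΨ₀e' : ∀ s t, y ≤ s → s + 1 ≤ t → t ≤ x → Complex.exp (Ψ₀ (s, t)) = Γ t - Γ s := by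
    intro s t h1 h2 h3
    rw [hΨ₀e]
    simp [hcs s h1 (by linarith), h2, h3]
  obtain ⟨Ψ, hΨ, hΨe, hΨθ⟩ : ∃ Ψ : ℝ × ℝ → ℂ, Continuous Ψ ∧
      (∀ s t, y ≤ s → s + 1 ≤ t → t ≤ x → Complex.exp (Ψ (s, t)) = Γ t - Γ s) ∧
      ∀ s, y ≤ s → s + 1 ≤ x → Ψ (s, s + 1) = θ (Γ s) := by
    obtain ⟨m, hm⟩ := continuous_log_unique (G := fun s => Ψ₀ (c s, c s + 1))
      (H := fun s => θ (Γ (c s))) (by fun_prop) (by fun_prop) (by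
        intro s
        rw [hΨ₀e' _ _ (hc1 s) le_rfl (by linarith [hc2 s]), hθe, hk])
    refine ⟨fun p => Ψ₀ p - m * (2 * Real.pi * Complex.I), by fun_prop, fun s t h1 h2 h3 => ?_,
      fun s h1 h2 => ?_⟩
    · rw [Complex.exp_sub, hΨ₀e' s t h1 h2 h3, Complex.exp_int_mul_two_pi_mul_I, div_one]
    · have := hm s
      rw [hcs s h1 (by linarith)] at this
      simp only [this]; ring
  obtain ⟨k, hk'⟩ := continuous_log_unique (G := fun s => H (Γ (c s), Ψ (c s, x)))
    (H := fun s => Ψ (y, c s + 1) + Real.pi * Complex.I) (by fun_prop) (by fun_prop) (by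
      intro s
      have h1 := hc1 s
      have h2 := hc2 s
      rw [Complex.exp_add, Complex.exp_pi_mul_I, hexp, hΨe _ _ h1 (by linarith) le_rfl,
        hΨe _ _ le_rfl (by linarith) (by linarith), add_sub_cancel, hk, hk, hclose]
      ring)
  have hx := hk' (x - 1)
  have hy := hk' y
  rw [hcs _ (by linarith) le_rfl] at hx
  rw [hcs _ le_rfl (by linarith)] at hy
  have e1 := hΨθ (x - 1) (by linarith) (by linarith)
  simp only [sub_add_cancel] at e1 hx
  rw [e1, hHθ, hk, sub_add_cancel] at hx
  rw [hΨθ y le_rfl hxy] at hy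
  have hs := log_increment_symm (k := fun z => h (h z)) hH hexp hper (Γ y) (Ψ (y, x))
  rw [hΨe _ _ le_rfl hxy le_rfl, add_sub_cancel, hy] at hs
  have ha := hHθ (Γ x)
  rw [hk, hclose, hx, log_increment_shift (H := H) (d := 1) (by simpa using hper), hs] at ha
  have h3 : ((2 * k + 1 : ℤ) : ℂ) * (2 * Real.pi * Complex.I)
      = (0 : ℤ) * (2 * Real.pi * Complex.I) := by
    push_cast at ha ⊢
    linear_combination ha
  have h4 : (2 * k + 1 : ℤ) = 0 := by
    exact_mod_cast mul_right_cancel₀ Complex.two_pi_I_ne_zero h3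
  omega

theorem continuous_zpow_floor_fract {Y : Type*} [TopologicalSpace Y] (k : Y ≃ₜ Y) {α : ℝ → Y}
    (hα : Continuous α)
    (h01 : α 1 = k (α 0)) :
    Continuous fun s : ℝ => (k ^ ⌊s⌋) (α (Int.fract s)) := by
  have hlf : LocallyFinite fun n : ℤ => Icc (n : ℝ) (n + 1) :=
    locallyFinite_Icc_of_tendsto tendsto_intCast_atTop_atTop
      (Filter.tendsto_atBot_add_const_right _ _ (tendsto_intCast_atBot_iff.2 Filter.tendsto_id))
  refine hlf.continuous (iUnion_Icc_intCast ℝ) (fun n => isClosed_Icc) fun n => ?_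
  have : ContinuousOn (fun s : ℝ => (k ^ n) (α (s - n))) (Icc (n : ℝ) (n + 1)) := by fun_prop
  refine this.congr fun s hs => ?_
  rcases hs.2.lt_or_eq with h | h
  · have : ⌊s⌋ = n := Int.floor_eq_iff.2 ⟨hs.1, h⟩
    simp [Int.fract, this]
  · have : ⌊s⌋ = n + 1 := by rw [h]; simp
    have h2 : (n : ℝ) + 1 - n = 1 := by ring
    simp only [Int.fract, h, h2, h01]
    simp [zpow_add_one]

theorem exists_path_through (z₀ p q a b : ℂ) {r : ℝ} (hp : dist p z₀ ≤ r) (hq : dist q z₀ ≤ r)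
    (ha : dist a z₀ < r) (hb : dist b z₀ < r) :
    ∃ α : ℝ → ℂ, Continuous α ∧ α 0 = p ∧ α 1 = q ∧ α (1 / 3) = b ∧ α (2 / 3) = a ∧
      ∀ t, 0 < t → t < 1 → dist (α t) z₀ < r := by
  refine ⟨fun t => z₀ + (((max 0 (1 - 3 * t) : ℝ) : ℂ) * (p - z₀)
    + ((max 0 (1 - |3 * t - 1|) : ℝ) : ℂ) * (b - z₀)
    + ((max 0 (1 - |3 * t - 2|) : ℝ) : ℂ) * (a - z₀)
    + ((max 0 (3 * t - 2) : ℝ) : ℂ) * (q - z₀)), by fun_prop, ?_, ?_, ?_, ?_, ?_⟩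
  · norm_num
  · norm_num
  · norm_num
  · norm_num
  · intro t h0 h1
    rw [dist_eq_norm] at *
    rw [add_sub_cancel_left]
    set w₁ := max 0 (1 - 3 * t) with h₁
    set w₂ := max 0 (1 - |3 * t - 1|) with h₂
    set w₃ := max 0 (1 - |3 * t - 2|) with h₃
    set w₄ := max 0 (3 * t - 2) with h₄
    have n₁ : 0 ≤ w₁ := le_max_left _ _
    have n₂ : 0 ≤ w₂ := le_max_left _ _
    have n₃ : 0 ≤ w₃ := le_max_left _ _
    have n₄ : 0 ≤ w₄ := le_max_left _ _
    have hsum : w₁ + w₂ + w₃ + w₄ = 1 ∧ 0 < w₂ + w₃ := by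
      rw [h₁, h₂, h₃, h₄]
      rcases max_cases 0 (1 - 3 * t) with c | c <;>
        rcases max_cases 0 (1 - |3 * t - 1|) with d | d <;>
        rcases max_cases 0 (1 - |3 * t - 2|) with e | e <;>
        rcases max_cases 0 (3 * t - 2) with f | f <;>
        rcases abs_cases (3 * t - 1) with g | g <;> rcases abs_cases (3 * t - 2) with i | i <;>
        constructor <;> linarith
    have b₁ : ‖(w₁ : ℂ) * (p - z₀)‖ ≤ w₁ * r := by
      rw [norm_mul, Complex.norm_of_nonneg n₁]; gcongr
    have b₄ : ‖(w₄ : ℂ) * (q - z₀)‖ ≤ w₄ * r := by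
      rw [norm_mul, Complex.norm_of_nonneg n₄]; gcongr
    have b₂ : ‖(w₂ : ℂ) * (b - z₀)‖ = w₂ * ‖b - z₀‖ := by
      rw [norm_mul, Complex.norm_of_nonneg n₂]
    have b₃ : ‖(w₃ : ℂ) * (a - z₀)‖ = w₃ * ‖a - z₀‖ := by
      rw [norm_mul, Complex.norm_of_nonneg n₃]
    refine norm_add₄_le.trans_lt ?_
    rw [b₂, b₃]
    have hlt : w₂ * ‖b - z₀‖ + w₃ * ‖a - z₀‖ < (w₂ + w₃) * r := by
      rcases n₂.lt_or_eq with h | h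
      · nlinarith
      · rw [← h] at hsum ⊢
        nlinarith [hsum.2]
    have e : w₁ * r + (w₂ + w₃) * r + w₄ * r = r := by linear_combination r * hsum.1
    linarith

/-- Brouwer: a fixed point free square of a homeomorphism of the plane has only wandering
points. -/
theorem exists_wandering_nhd (h : ℂ ≃ₜ ℂ) (hfix : ∀ z, h (h z) ≠ z) (z₀ : ℂ) :
    ∃ D : Set ℂ, IsOpen D ∧ z₀ ∈ D ∧
      ∀ n : ℕ, 1 ≤ n → ∀ a ∈ D, ((h.trans h) ^ n) a ∉ D := by
  set k : ℂ ≃ₜ ℂ := h.trans h with hk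
  have hkz : ∀ z, k z = h (h z) := fun z => rfl
  obtain ⟨p, hp⟩ := Continuous.exists_forall_le (f := fun a => max (dist a z₀) (dist (k a) z₀))
    (by fun_prop) (Filter.tendsto_atTop_mono (fun a => le_max_left _ _)
      (tendsto_dist_right_cocompact_atTop z₀))
  set r := max (dist p z₀) (dist (k p) z₀) with hr
  have hpr : dist p z₀ ≤ r := le_max_left _ _
  have hqr : dist (k p) z₀ ≤ r := le_max_right _ _
  have hr0 : 0 < r := by
    by_contra hcon
    have h1 : dist p z₀ = 0 := le_antisymm (by linarith) dist_nonneg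
    have h2 : dist (k p) z₀ = 0 := le_antisymm (by linarith) dist_nonneg
    exact hfix p (by rw [← hkz, dist_eq_zero.1 h2, dist_eq_zero.1 h1])
  refine ⟨Metric.ball z₀ r, Metric.isOpen_ball, Metric.mem_ball_self hr0, ?_⟩
  by_contra hcon
  push Not at hcon
  have hfree : ∀ a ∈ Metric.ball z₀ r, k a ∉ Metric.ball z₀ r := fun a ha hka =>
    absurd (hp a) (not_le.2 (max_lt ha hka))
  classical
  set n := Nat.find hcon with hn
  obtain ⟨hn1, a, ha, hb⟩ := Nat.find_spec hcon
  rw [← hn] at hn1 hb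
  have hn2 : 2 ≤ n := by
    by_contra hlt
    have : n = 1 := by omega
    rw [this, pow_one] at hb
    exact hfree a ha hb
  have hmin : ∀ d : ℕ, 1 ≤ d → d < n → ∀ a ∈ Metric.ball z₀ r, (k ^ d) a ∉ Metric.ball z₀ r := by
    intro d h1 h2 a ha hka
    exact Nat.find_min hcon h2 ⟨h1, a, ha, hka⟩
  obtain ⟨α, hα, hα0, hα1, hαb, hαa, hαr⟩ :=
    exists_path_through z₀ p (k p) a ((k ^ n) a) hpr hqr ha hb
  have hclb : closure (Metric.ball z₀ r) = Metric.closedBall z₀ r := closure_ball _ hr0.ne'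
  have hαcl : ∀ t, 0 ≤ t → t < 1 → α t ∈ closure (Metric.ball z₀ r) := by
    intro t h0 h1
    rw [hclb]
    rcases h0.lt_or_eq with h | h
    · exact (hαr t h h1).le
    · rw [← h, hα0]; exact hpr
  have hmin' : ∀ d : ℕ, 1 ≤ d → d < n → ∀ u ∈ closure (Metric.ball z₀ r),
      (k ^ d) u ∉ Metric.ball z₀ r := by
    intro d h1 h2 u hu hku
    obtain ⟨v, hv, hv'⟩ := mem_closure_iff.1 hu _
      (Metric.isOpen_ball.preimage (k ^ d).continuous) hku
    exact hmin d h1 h2 v hv' hv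
  have hmin'' : ∀ d : ℕ, 1 ≤ d → d < n → ∀ u ∈ Metric.ball z₀ r,
      (k ^ d) u ∉ closure (Metric.ball z₀ r) := by
    intro d h1 h2 u hu hku
    obtain ⟨v, hv, hv'⟩ := mem_closure_iff.1 hku _
      ((k ^ d).isOpenMap _ Metric.isOpen_ball) ⟨u, hu, rfl⟩
    obtain ⟨w, hw, rfl⟩ := hv
    exact hmin d h1 h2 w hw hv'
  set Γ : ℝ → ℂ := fun s => (k ^ ⌊s⌋) (α (Int.fract s)) with hΓ
  have hΓc : Continuous Γ := continuous_zpow_floor_fract k hα (by rw [hα1, hα0])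
  have hΓk : ∀ s, h (h (Γ s)) = Γ (s + 1) := by
    intro s
    simp only [hΓ, Int.floor_add_one, Int.fract_add_one, add_comm _ (1 : ℤ), zpow_one_add]
    rfl
  have hco : ∀ s t : ℝ, 0 ≤ s → s + 1 ≤ t → t < n → Γ s = Γ t →
      ∃ d : ℕ, 1 ≤ d ∧ (d : ℝ) ≤ t ∧ (k ^ d) p = p := by
    intro s t hs hst htn heq
    have hf : ⌊s⌋ + 1 ≤ ⌊t⌋ := by rw [← Int.floor_add_one]; exact Int.floor_le_floor hst
    have hs0 : 0 ≤ ⌊s⌋ := Int.floor_nonneg.2 hs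
    have htn' : ⌊t⌋ < n := by rw [Int.floor_lt]; exact_mod_cast htn
    obtain ⟨d, hd⟩ := Int.eq_ofNat_of_zero_le (show 0 ≤ ⌊t⌋ - ⌊s⌋ by omega)
    have hd1 : 1 ≤ d := by omega
    have hdn : d < n := by omega
    have hdt : (d : ℝ) ≤ t := by
      have : (d : ℤ) ≤ ⌊t⌋ := by omega
      exact_mod_cast Int.le_floor.1 this
    have hαα : α (Int.fract s) = (k ^ d) (α (Int.fract t)) := by
      have : ⌊t⌋ = ⌊s⌋ + (d : ℤ) := by omega
      simp only [hΓ] at heq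
      rw [this, zpow_add] at heq
      exact (k ^ ⌊s⌋).injective heq
    refine ⟨d, hd1, hdt, ?_⟩
    rcases (Int.fract_nonneg s).lt_or_eq with h1 | h1
    · refine absurd ?_ (hmin' d hd1 hdn _ (hαcl _ (Int.fract_nonneg t) (Int.fract_lt_one t)))
      rw [← hαα]
      exact hαr _ h1 (Int.fract_lt_one s)
    · rcases (Int.fract_nonneg t).lt_or_eq with h2 | h2
      · refine absurd ?_ (hmin'' d hd1 hdn _ (hαr _ h2 (Int.fract_lt_one t)))
        rw [← hαα]
        exact hαcl _ (Int.fract_nonneg s) (Int.fract_lt_one s)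
      · rw [← h1, ← h2, hα0] at hαα
        exact hαα.symm
  by_cases hper : ∃ j : ℕ, 1 ≤ j ∧ (k ^ j) p = p ∧ j ≤ n
  · set j := Nat.find hper with hj
    obtain ⟨hj1, hjp, hjn⟩ := Nat.find_spec hper
    rw [← hj] at hj1 hjp hjn
    have hj2 : 2 ≤ j := by
      by_contra hlt
      have : j = 1 := by omega
      rw [this, pow_one] at hjp
      exact hfix p hjp
    have hj2' : (2 : ℝ) ≤ j := by exact_mod_cast hj2
    have hjn' : (j : ℝ) ≤ n := by exact_mod_cast hjn
    refine no_closing_translation_path h hfix hΓc hΓk (y := 0) (x := j - 1) (by linarith)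
      (fun s t h1 h2 h3 heq => ?_) ?_
    · obtain ⟨d, hd1, hdt, hdp⟩ := hco s t h1 h2 (by linarith) heq
      have hdj : d < j := by
        have : (d : ℝ) < j := by linarith
        exact_mod_cast this
      exact Nat.find_min hper hdj ⟨hd1, hdp, by omega⟩
    · simp [hΓ, hα0, hjp]
  · have hn2' : (2 : ℝ) ≤ n := by exact_mod_cast hn2
    have f1 : ⌊(1 / 3 : ℝ)⌋ = 0 := by norm_num
    have f2 : ⌊(n : ℝ) + 2 / 3⌋ = n := by
      rw [Int.floor_eq_iff]; constructor <;> push_cast <;> linarith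
    refine no_closing_translation_path h hfix hΓc hΓk (y := 1 / 3) (x := n - 1 + 2 / 3)
      (by linarith) (fun s t h1 h2 h3 heq => ?_) ?_
    · obtain ⟨d, hd1, hdt, hdp⟩ := hco s t (by linarith) h2 (by linarith) heq
      refine hper ⟨d, hd1, hdp, ?_⟩
      have : (d : ℝ) < n := by linarith
      exact le_of_lt (by exact_mod_cast this)
    · rw [show (n : ℝ) - 1 + 2 / 3 + 1 = n + 2 / 3 by ring]
      simp only [hΓ, Int.fract, f1, f2]
      simp only [Int.cast_natCast, add_sub_cancel_left, hαa, Int.cast_zero, sub_zero, hαb]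
      simp

theorem isOpenMap_annulusProj : IsOpenMap annulusProj :=
  QuotientAddGroup.isOpenMap_coe.prodMap IsOpenMap.id

theorem continuous_annulusProj : Continuous annulusProj :=
  ((AddCircle.continuous_mk' 1).comp continuous_fst).prodMk continuous_snd

theorem surjective_annulusProj : Function.Surjective annulusProj := by
  rintro ⟨x, y⟩
  obtain ⟨x, rfl⟩ := QuotientAddGroup.mk_surjective x
  exact ⟨(x, y), rfl⟩

/-- The deck transformation `(x,y) ↦ (x+1,y)`. -/
def deck : AnnulusCover ≃ₜ AnnulusCover :=
  (Homeomorph.addRight (1 : ℝ)).prodCongr (Homeomorph.refl _)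

theorem deck_apply (z : AnnulusCover) : deck z = (z.1 + 1, z.2) := rfl

theorem deck_zpow_apply (k : ℤ) (z : AnnulusCover) : (deck ^ k) z = (z.1 + k, z.2) := by
  induction k using Int.induction_on with
  | zero => simp
  | succ i ih =>
    rw [add_comm, zpow_one_add, Homeomorph.mul_apply, ih, deck_apply]
    ext <;> simp; ring
  | pred i ih =>
    apply deck.injective
    rw [← Homeomorph.mul_apply, ← zpow_one_add, add_sub_cancel, ih, deck_apply]
    ext <;> simp; ring

theorem annulusProj_eq_iff {z w : AnnulusCover} :
    annulusProj z = annulusProj w ↔ ∃ k : ℤ, z = (deck ^ k) w := by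
  simp only [annulusProj, deck_zpow_apply, Prod.ext_iff]
  rw [show (z.1 : AddCircle (1 : ℝ)) = w.1 ↔ ∃ k : ℤ, z.1 = w.1 + k from ?_]
  · exact ⟨fun ⟨⟨k, h⟩, h'⟩ => ⟨k, h, h'⟩, fun ⟨k, h, h'⟩ => ⟨⟨k, h⟩, h'⟩⟩
  · rw [eq_comm, QuotientAddGroup.eq, AddSubgroup.mem_zmultiples_iff]
    refine exists_congr fun k => ?_
    simp only [zsmul_eq_mul, mul_one]
    constructor <;> intro h <;> linarith

theorem annulusProj_deck_zpow (k : ℤ) (z : AnnulusCover) :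
    annulusProj ((deck ^ k) z) = annulusProj z :=
  annulusProj_eq_iff.2 ⟨k, rfl⟩

/-- The interior of the cover. -/
def coverInt : Set AnnulusCover := {z | -1 < (z.2 : ℝ) ∧ (z.2 : ℝ) < 1}

theorem isOpen_coverInt : IsOpen coverInt := by
  have h : Continuous fun z : AnnulusCover => (z.2 : ℝ) := by fun_prop
  exact (isOpen_lt continuous_const h).inter (isOpen_lt h continuous_const)

theorem isOpen_annulusInt : IsOpen annulusInt := by
  have h : Continuous fun z : Annulus => (z.2 : ℝ) := by fun_prop
  exact (isOpen_lt continuous_const h).inter (isOpen_lt h continuous_const)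

/-- The retraction of the plane onto the cover. -/
def coverRetract (p : ℝ × ℝ) : AnnulusCover := (p.1, projIcc (-1) 1 (by norm_num) p.2)

theorem continuous_coverRetract : Continuous coverRetract :=
  continuous_fst.prodMk (continuous_projIcc.comp continuous_snd)

theorem isQuotientMap_coverRetract : Topology.IsQuotientMap coverRetract :=
  .of_inverse (f := fun z : AnnulusCover => (z.1, (z.2 : ℝ))) (by fun_prop) continuous_coverRetract
    fun z => by simp [coverRetract]

theorem coverRetract_snd {p : ℝ × ℝ} (h : p.2 ∈ Icc (-1 : ℝ) 1) :
    ((coverRetract p).2 : ℝ) = p.2 := by simp [coverRetract, projIcc_of_mem _ h]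

instance : LocallyPathConnectedSpace AnnulusCover :=
  isQuotientMap_coverRetract.locallyPathConnectedSpace

/-- The cover as a subset of the complex plane. -/
def coverCoord (z : AnnulusCover) : ℂ := ⟨z.1, z.2⟩

theorem continuous_coverCoord : Continuous coverCoord := by
  have : coverCoord = fun z : AnnulusCover => (z.1 : ℂ) + (z.2 : ℝ) * Complex.I := by
    funext z; apply Complex.ext <;> simp [coverCoord]
  rw [this]; fun_prop

theorem injective_coverCoord : Function.Injective coverCoord := by
  rintro ⟨x, y⟩ ⟨x', y'⟩ h
  simp only [coverCoord, Complex.mk.injEq] at h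
  exact Prod.ext h.1 (Subtype.ext h.2)

theorem contractible_strip_diff_boundary_point {e : AnnulusCover} (he : e ∉ coverInt) :
    ContractibleSpace {p : ℝ × ℝ | p.2 ∈ Icc (-1 : ℝ) 1 ∧ p ≠ (e.1, (e.2 : ℝ))} := by
  have h1 := e.2.2.1
  have h2 := e.2.2.2
  have hey : (e.2 : ℝ) = -1 ∨ (e.2 : ℝ) = 1 := by
    by_contra! hcon
    exact he ⟨lt_of_le_of_ne h1 hcon.1.symm, lt_of_le_of_ne h2 hcon.2⟩
  refine StarConvex.contractibleSpace (x := (e.1, 0)) ?_ ⟨(e.1, 0), by norm_num, ?_⟩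
  · rintro ⟨x, y⟩ ⟨⟨hy1, hy2⟩, hne⟩ a b ha hb hab
    simp only [mem_ofPred_eq, Prod.smul_mk, Prod.mk_add_mk, smul_eq_mul, mul_zero, zero_add, mem_Icc,
      Ne, Prod.mk.injEq, not_and] at *
    refine ⟨⟨by nlinarith, by nlinarith⟩, fun hx hy => ?_⟩
    have hb1 : b = 1 := by
      rcases hey with h | h <;> rw [h] at hy <;> nlinarith
    subst hb1
    have : a = 0 := by linarith
    subst this
    exact hne (by linarith) (by linarith)
  · intro h
    have : (0 : ℝ) = e.2 := (Prod.ext_iff.1 h).2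
    rcases hey with h | h <;> rw [h] at this <;> norm_num at this

/-- A homeomorphism of the closed strip preserves its interior. -/
theorem mapsTo_coverInt (F : AnnulusCover ≃ₜ AnnulusCover) {b : AnnulusCover} (hb : b ∈ coverInt) :
    F b ∈ coverInt := by
  by_contra he
  have := contractible_strip_diff_boundary_point he
  obtain ⟨G, hG, hGe⟩ := exists_continuous_log
    (X := {p : ℝ × ℝ | p.2 ∈ Icc (-1 : ℝ) 1 ∧ p ≠ ((F b).1, ((F b).2 : ℝ))})
    (F := fun p => coverCoord (F.symm (p.1.1, ⟨p.1.2, p.2.1⟩)) - coverCoord b)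
    (by
      have := continuous_coverCoord
      fun_prop)
    (by
      rintro ⟨p, hp, hpne⟩ h
      have h1 := injective_coverCoord (sub_eq_zero.1 h)
      rw [Homeomorph.symm_apply_eq] at h1
      exact hpne (by rw [← h1]))
  obtain ⟨hb1, hb2⟩ := hb
  obtain ⟨ρ, hρ, hρ1, hρ2⟩ : ∃ ρ : ℝ, 0 < ρ ∧ -1 < b.2 - ρ ∧ b.2 + ρ < 1 :=
    ⟨min (1 + (b.2 : ℝ)) (1 - b.2) / 2, by
      have : 0 < min (1 + (b.2 : ℝ)) (1 - b.2) := lt_min (by linarith) (by linarith)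
      linarith, by linarith [min_le_left (1 + (b.2 : ℝ)) (1 - b.2)], by
      linarith [min_le_right (1 + (b.2 : ℝ)) (1 - b.2)]⟩
  have hmem : ∀ θ : ℝ, (b.2 : ℝ) + ρ * Real.sin θ ∈ Icc (-1 : ℝ) 1 := fun θ =>
    ⟨by nlinarith [Real.neg_one_le_sin θ], by nlinarith [Real.sin_le_one θ]⟩
  let L : ℝ → AnnulusCover := fun θ => (b.1 + ρ * Real.cos θ, ⟨b.2 + ρ * Real.sin θ, hmem θ⟩)
  have hL : Continuous L := by fun_prop
  have hLb : ∀ θ, coverCoord (L θ) - coverCoord b = ρ * Complex.exp (θ * Complex.I) := by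
    intro θ
    rw [Complex.exp_mul_I]
    apply Complex.ext <;> simp [L, coverCoord, Complex.cos_ofReal_re, Complex.sin_ofReal_re]
  have hLne : ∀ θ, L θ ≠ b := by
    intro θ h
    have := hLb θ
    rw [h, sub_self] at this
    have := mul_ne_zero (Complex.ofReal_ne_zero.2 hρ.ne') (Complex.exp_ne_zero (θ * Complex.I))
    simp_all
  have hLp : L (2 * Real.pi) = L 0 := by simp [L]
  obtain ⟨n, hn⟩ := continuous_log_unique
    (G := fun θ : ℝ => G ⟨((F (L θ)).1, ((F (L θ)).2 : ℝ)), (F (L θ)).2.2, fun h =>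
      hLne θ (F.injective (Prod.ext (Prod.ext_iff.1 h).1 (Subtype.ext (Prod.ext_iff.1 h).2)))⟩)
    (H := fun θ : ℝ => Complex.log ρ + θ * Complex.I) (by fun_prop) (by fun_prop) (by
      intro θ
      rw [hGe, Complex.exp_add, Complex.exp_log (Complex.ofReal_ne_zero.2 hρ.ne'), ← hLb]
      simp)
  have h0 := hn 0
  have h2 := hn (2 * Real.pi)
  simp only [hLp] at h2
  rw [h0] at h2
  have : (2 * Real.pi * Complex.I) = 0 := by push_cast at h2; linear_combination -h2
  exact Complex.two_pi_I_ne_zero this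

theorem mem_coverInt_iff (F : AnnulusCover ≃ₜ AnnulusCover) {b : AnnulusCover} :
    F b ∈ coverInt ↔ b ∈ coverInt :=
  ⟨fun h => by simpa using mapsTo_coverInt F.symm h, mapsTo_coverInt F⟩

/-- Two paths crossing a rectangle in transverse directions meet. -/
theorem exists_crossing {γ δ : ℝ → ℂ} (hγ : Continuous γ) (hδ : Continuous δ)
    (hl : ∀ s, (γ 0).re < (δ s).re) (hr : ∀ s, (δ s).re < (γ 1).re)
    (hd : ∀ t, (δ 0).im < (γ t).im) (hu : ∀ t, (γ t).im < (δ 1).im) : ∃ s t, δ s = γ t := by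
  by_contra! hne
  obtain ⟨G, hG, hGe⟩ := exists_continuous_log (F := fun p : ℝ × ℝ => δ p.1 - γ p.2)
    (by fun_prop) (fun p => sub_ne_zero.2 (hne p.1 p.2))
  have key : ∀ (c : ℂ) (σ : ℝ → ℂ) (g : ℝ → ℂ), Continuous σ → Continuous g → c ≠ 0 →
      (∀ s, Complex.exp (g s) = σ s) → (∀ s, 0 < (c * σ s).re) →
      g 1 - g 0 = Complex.log (c * σ 1) - Complex.log (c * σ 0) := by
    intro c σ g hσ hg hc hge hpos
    obtain ⟨n, hn⟩ := continuous_log_unique (G := fun s => g s + Complex.log c)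
      (H := fun s => Complex.log (c * σ s)) (by fun_prop)
      (continuous_iff_continuousAt.2 fun s =>
        (by fun_prop : ContinuousAt (fun s => c * σ s) s).clog (Or.inl (hpos s))) (by
        intro s
        rw [Complex.exp_add, hge, Complex.exp_log hc, Complex.exp_log, mul_comm]
        exact fun h => by simpa [h] using hpos s)
    linear_combination hn 1 - hn 0
  have rot : ∀ w : ℂ, 0 < w.re → w.im < 0 →
      Complex.log (Complex.I * w) = Complex.log w + Real.pi / 2 * Complex.I := by
    intro w h1 h2
    have hw : w ≠ 0 := fun h => by simp [h] at h1
    have harg := Complex.arg_neg_iff.2 h2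
    rw [Complex.log_mul Complex.I_ne_zero hw, Complex.log_I, add_comm]
    have := Complex.neg_pi_lt_arg w
    have := Real.pi_pos
    rw [Complex.arg_I]
    constructor <;> linarith
  have k1 := key 1 (fun s => δ s - γ 0) (fun s => G (s, 0)) (by fun_prop) (by fun_prop) (by simp)
    (fun s => hGe (s, 0)) (fun s => by simpa using hl s)
  have k2 := key (-Complex.I) (fun t => δ 1 - γ t) (fun t => G (1, t)) (by fun_prop) (by fun_prop)
    (by simp) (fun s => hGe (1, s)) (fun s => by simpa using hu s)
  have k3 := key (-1) (fun s => δ s - γ 1) (fun s => G (s, 1)) (by fun_prop) (by fun_prop) (by simp)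
    (fun s => hGe (s, 1)) (fun s => by simpa using hr s)
  have k4 := key Complex.I (fun t => δ 0 - γ t) (fun t => G (0, t)) (by fun_prop) (by fun_prop)
    (by simp) (fun s => hGe (0, s)) (fun s => by simpa using hd s)
  have r1 := rot (1 * (δ 0 - γ 0)) (by simpa using hl 0) (by simpa using hd 0)
  have r2 := rot (-Complex.I * (δ 1 - γ 0)) (by simpa using hu 0) (by simpa using hl 1)
  have r3 := rot (-1 * (δ 1 - γ 1)) (by simpa using hr 1) (by simpa using hu 1)
  have r4 := rot (Complex.I * (δ 0 - γ 1)) (by simpa using hd 1) (by simpa using hr 0)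
  rw [← mul_assoc] at r1 r2 r3 r4
  simp only [mul_neg, Complex.I_mul_I, neg_neg, mul_one] at r1 r2 r3 r4 k1 k2 k3 k4
  have : (2 * Real.pi * Complex.I) = 0 := by
    linear_combination -k1 - k2 + k3 + k4 - r1 - r2 - r3 - r4
  exact Complex.two_pi_I_ne_zero this

theorem homeomorph_pow_apply {Y : Type*} [TopologicalSpace Y] (f : Y ≃ₜ Y) (n : ℕ) (y : Y) :
    (f ^ n) y = f^[n] y := by
  induction n with
  | zero => rfl
  | succ n ih => rw [pow_succ', Function.iterate_succ_apply', ← ih]; rfl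

theorem measurePreserving_pow {f : Annulus ≃ₜ Annulus} (h : MeasurePreserving f volume volume)
    (n : ℕ) : MeasurePreserving (f ^ n : Annulus ≃ₜ Annulus) volume volume := by
  rw [show ⇑(f ^ n) = f^[n] from funext (homeomorph_pow_apply f n)]
  exact h.iterate n

instance : IsFiniteMeasure (volume : Measure (Icc (-1 : ℝ) 1)) :=
  ⟨by
    rw [Measure.Subtype.volume_univ measurableSet_Icc.nullMeasurableSet]
    simp⟩

instance : (volume : Measure (Icc (-1 : ℝ) 1)).IsOpenPosMeasure := by
  refine ⟨fun U hU hne h0 => ?_⟩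
  obtain ⟨V, hV, rfl⟩ := isOpen_induced_iff.1 hU
  obtain ⟨y, hy⟩ := hne
  have hcl : (y : ℝ) ∈ closure (Ioo (-1 : ℝ) 1) := by
    rw [closure_Ioo (by norm_num)]; exact y.2
  have hpos := (hV.inter isOpen_Ioo).measure_pos volume (mem_closure_iff.1 hcl V hV hy)
  rw [volume_set_coe_def, comap_subtype_coe_apply measurableSet_Icc,
    Subtype.image_preimage_coe] at h0
  refine hpos.ne' (measure_mono_null ?_ h0)
  exact fun x hx => ⟨Ioo_subset_Icc_self hx.2, hx.1⟩

namespace IsLift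

variable {f g : Annulus ≃ₜ Annulus} {ft gt : AnnulusCover ≃ₜ AnnulusCover}

theorem commute (h : IsLift f ft) : Commute ft deck :=
  Homeomorph.ext fun z => h.1 z

theorem of_commute (h : Commute ft deck) (h' : ∀ z, f (annulusProj z) = annulusProj (ft z)) :
    IsLift f ft :=
  ⟨fun z => congr_arg (fun F : AnnulusCover ≃ₜ AnnulusCover => F z) h.eq, h'⟩

theorem mul (h : IsLift f ft) (h' : IsLift g gt) : IsLift (f * g) (ft * gt) :=
  of_commute (h.commute.mul_left h'.commute) fun z => by
    rw [Homeomorph.mul_apply, h'.2, h.2]; rfl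

theorem pow (h : IsLift f ft) (n : ℕ) : IsLift (f ^ n) (ft ^ n) := by
  induction n with
  | zero => exact of_commute (Commute.one_left _) fun z => rfl
  | succ n ih => rw [pow_succ, pow_succ]; exact ih.mul h

theorem deck_zpow_mul (h : IsLift f ft) (k : ℤ) : IsLift f (deck ^ k * ft) :=
  of_commute (((Commute.refl deck).zpow_left k).mul_left h.commute) fun z => by
    rw [Homeomorph.mul_apply, annulusProj_deck_zpow, h.2]

theorem mem_annulusInt_iff (h : IsLift f ft) (z : Annulus) :
    f z ∈ annulusInt ↔ z ∈ annulusInt := by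
  obtain ⟨z, rfl⟩ := surjective_annulusProj z
  rw [h.2]
  exact mem_coverInt_iff ft

/-- Poincaré recurrence, seen in the cover. -/
theorem exists_recurrence (h : IsLift f ft) (harea : MeasurePreserving f volume volume)
    {V : Set AnnulusCover} (hV : IsOpen V) (hne : V.Nonempty) :
    ∃ m : ℕ, m ≠ 0 ∧ ∃ x ∈ V, ∃ y ∈ V, ∃ l : ℤ, (ft ^ m) x = (deck ^ l) y := by
  have hopen := isOpenMap_annulusProj V hV
  obtain ⟨_, ⟨x, hx, rfl⟩, m, hm, y, hy, hxy⟩ := harea.conservative.exists_mem_iterate_mem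
    hopen.measurableSet.nullMeasurableSet (hopen.measure_pos volume (hne.image _)).ne'
  rw [← homeomorph_pow_apply, (h.pow m).2, eq_comm, annulusProj_eq_iff] at hxy
  exact ⟨m, hm, x, hx, y, hy, hxy⟩

end IsLift

theorem NICIS.pow {f : Annulus ≃ₜ Annulus} (h : NICIS f)
    (hmaps : ∀ z, f z ∈ annulusInt ↔ z ∈ annulusInt) {n : ℕ} (hn : n ≠ 0) : NICIS (f ^ n) := by
  rintro ⟨K, ⟨z, hz⟩, hK, hinv, hKi⟩
  have hpow : ∀ i : ℕ, ∀ z ∈ annulusInt, (f ^ i) z ∈ annulusInt := by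
    intro i z hz
    induction i with
    | zero => exact hz
    | succ i ih => rw [pow_succ']; exact (hmaps _).2 ih
  obtain ⟨n, rfl⟩ := Nat.exists_eq_succ_of_ne_zero hn
  refine h ⟨⋃ i ∈ Finset.range (n + 1), (f ^ i : Annulus ≃ₜ Annulus) '' K, ⟨z, ?_⟩, ?_, ?_, ?_⟩
  · exact mem_iUnion₂.2 ⟨0, by simp, z, hz, rfl⟩
  · exact (Finset.range (n + 1)).isCompact_biUnion fun i _ => hK.image (f ^ i).continuous
  · have hs : ∀ i : ℕ, f '' ((f ^ i : Annulus ≃ₜ Annulus) '' K)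
        = (f ^ (i + 1) : Annulus ≃ₜ Annulus) '' K := by
      intro i; rw [image_image, pow_succ']; rfl
    simp only [image_iUnion, hs]
    ext w
    simp only [mem_iUnion, Finset.mem_range, exists_prop]
    constructor
    · rintro ⟨i, hi, hw⟩
      rcases Nat.lt_or_ge (i + 1) (n + 1) with h1 | h1
      · exact ⟨i + 1, h1, hw⟩
      · have : i + 1 = n + 1 := by omega
        rw [this, hinv] at hw
        exact ⟨0, by omega, by simpa using hw⟩
    · rintro ⟨i, hi, hw⟩
      rcases i with _ | i
      · refine ⟨n, by omega, ?_⟩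
        rw [hinv]
        simpa using hw
      · exact ⟨i, by omega, hw⟩
  · simp only [iUnion_subset_iff]
    rintro i - _ ⟨w, hw, rfl⟩
    exact hpow i w (hKi hw)

theorem image_connectedComponentIn_eq {Y : Type*} [TopologicalSpace Y] (F : Y ≃ₜ Y) {A : Set Y}
    (hA : ∀ y, F y ∈ A ↔ y ∈ A) {z w : Y} (hw : w ∈ connectedComponentIn A z)
    (hFw : F w ∈ connectedComponentIn A z) :
    F '' connectedComponentIn A z = connectedComponentIn A z := by
  have hAi : F '' A = A := by
    ext y
    constructor
    · rintro ⟨x, hx, rfl⟩; exact (hA x).2 hx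
    · intro hy; exact ⟨F.symm y, (hA _).1 (by simpa using hy), by simp⟩
  rw [connectedComponentIn_eq hw, F.image_connectedComponentIn (connectedComponentIn_subset _ _ hw),
    hAi, ← connectedComponentIn_eq hFw, connectedComponentIn_eq hw]

/-- Brouwer: a fixed point free square on the open strip has only wandering points. -/
theorem exists_wandering_nhd_strip (g : AnnulusCover ≃ₜ AnnulusCover)
    (hfix : ∀ z ∈ coverInt, g (g z) ≠ z) {z₀ : AnnulusCover} (hz₀ : z₀ ∈ coverInt) :
    ∃ D : Set AnnulusCover, IsOpen D ∧ z₀ ∈ D ∧ ∀ n : ℕ, 1 ≤ n → ∀ a ∈ D, ((g * g) ^ n) a ∉ D := by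
  have habs : ∀ t : ℝ, 0 < 1 + |t| := fun t => by positivity
  have hlt : ∀ t : ℝ, |t / (1 + |t|)| < 1 := fun t => by
    rw [abs_div, abs_of_pos (habs t), div_lt_one (habs t)]; linarith
  let e : ℂ → AnnulusCover := fun w =>
    (w.re, ⟨w.im / (1 + |w.im|), (abs_lt.1 (hlt _)).1.le, (abs_lt.1 (hlt _)).2.le⟩)
  let r : AnnulusCover → ℂ := fun z => (z.1 : ℂ) + ((z.2 / (1 - |(z.2 : ℝ)|) : ℝ) : ℂ) * Complex.I
  have he : Continuous e := by
    have : ∀ w : ℂ, 1 + |w.im| ≠ 0 := fun w => (habs _).ne'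
    fun_prop (disch := assumption)
  have hei : ∀ w, e w ∈ coverInt := fun w => abs_lt.1 (hlt _)
  have hr : ContinuousOn r coverInt := by
    have : ∀ z ∈ coverInt, 1 - |(z.2 : ℝ)| ≠ 0 := fun z hz => by
      have := abs_lt.2 hz
      exact (by linarith : 0 < 1 - |(z.2 : ℝ)|).ne'
    fun_prop (disch := assumption)
  have hre : ∀ w, r (e w) = w := by
    intro w
    apply Complex.ext
    · simp only [r, e, Complex.add_re, Complex.re_ofReal_mul, Complex.ofReal_re, Complex.I_re,
        mul_zero, add_zero]
    · have := (habs w.im).ne'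
      simp only [r, e, Complex.add_im, Complex.ofReal_im, Complex.mul_im, Complex.ofReal_re,
        Complex.I_re, Complex.I_im, abs_div, abs_of_pos (habs w.im)]
      field_simp
      ring
  have her : ∀ z ∈ coverInt, e (r z) = z := by
    intro z hz
    have hpos : 0 < 1 - |(z.2 : ℝ)| := by linarith [abs_lt.2 hz]
    refine Prod.ext (by
      simp only [r, e, Complex.add_re, Complex.re_ofReal_mul, Complex.ofReal_re, Complex.I_re,
        mul_zero, add_zero]) (Subtype.ext ?_)
    simp only [r, e, Complex.add_im, Complex.ofReal_im, Complex.mul_im, Complex.ofReal_re,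
        Complex.I_re, Complex.I_im, mul_zero, mul_one, add_zero, zero_add, abs_div,
        abs_of_pos hpos]
    field_simp
    ring
  have hc : ∀ F : AnnulusCover ≃ₜ AnnulusCover, Continuous fun w => r (F (e w)) := fun F =>
    hr.comp_continuous (F.continuous.comp he) fun w => mapsTo_coverInt F (hei w)
  let h : ℂ ≃ₜ ℂ :=
    { toFun := fun w => r (g (e w))
      invFun := fun w => r (g.symm (e w))
      left_inv := fun w => by
        simp only [her _ (mapsTo_coverInt g (hei w)), Homeomorph.symm_apply_apply, hre]
      right_inv := fun w => by
        simp only [her _ (mapsTo_coverInt g.symm (hei w)), Homeomorph.apply_symm_apply, hre]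
      continuous_toFun := hc g
      continuous_invFun := hc g.symm }
  have heh : ∀ w, e (h w) = g (e w) := fun w => her _ (mapsTo_coverInt g (hei w))
  have hehn : ∀ (n : ℕ) w, e (((h.trans h) ^ n) w) = ((g * g) ^ n) (e w) := by
    intro n w
    induction n with
    | zero => rfl
    | succ n ih =>
      rw [pow_succ', pow_succ', Homeomorph.mul_apply, Homeomorph.mul_apply, ← ih]
      exact (heh _).trans (congr_arg g (heh _))
  obtain ⟨D, hD, hzD, hDw⟩ := exists_wandering_nhd h (fun w hw => hfix (e w) (hei w) (by
    rw [← heh, ← heh, hw])) (r z₀)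
  refine ⟨coverInt ∩ r ⁻¹' D, hr.isOpen_inter_preimage isOpen_coverInt hD, ⟨hz₀, hzD⟩, ?_⟩
  rintro n hn a ⟨ha, haD⟩ ⟨-, hb⟩
  refine hDw n hn (r a) haD ?_
  rw [← hre (((h.trans h) ^ n) (r a)), hehn, her a ha]
  exact hb

/-- The group of homeomorphisms preserving a set. -/
def homeomorphStab {Y : Type*} [TopologicalSpace Y] (A : Set Y) : Subgroup (Y ≃ₜ Y) where
  carrier := {F | ∀ y, F y ∈ A ↔ y ∈ A}
  mul_mem' {F G} hF hG y := (hF (G y)).trans (hG y)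
  one_mem' y := Iff.rfl
  inv_mem' {F} hF y := by
    have := hF (F⁻¹ y)
    rw [← Homeomorph.mul_apply, mul_inv_cancel] at this
    exact this.symm

theorem mem_homeomorphStab {Y : Type*} [TopologicalSpace Y] {A : Set Y} {F : Y ≃ₜ Y} :
    F ∈ homeomorphStab A ↔ ∀ y, F y ∈ A ↔ y ∈ A := Iff.rfl

theorem mem_homeomorphStab_iff_image {Y : Type*} [TopologicalSpace Y] {A : Set Y} {F : Y ≃ₜ Y} :
    F ∈ homeomorphStab A ↔ F '' A = A := by
  constructor
  · intro h
    ext y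
    constructor
    · rintro ⟨x, hx, rfl⟩; exact (h x).2 hx
    · intro hy; exact ⟨F.symm y, (h _).1 (by simpa using hy), by simp⟩
  · intro h y
    conv_lhs => rw [← h]
    exact F.injective.mem_set_image

theorem IsLift.exists_return {f : Annulus ≃ₜ Annulus} {ft : AnnulusCover ≃ₜ AnnulusCover}
    (hlift : IsLift f ft) (harea : MeasurePreserving f volume volume) {A : Set AnnulusCover}
    (hAo : IsOpen A) (hA : ft ∈ homeomorphStab A) (hAd : deck ∈ homeomorphStab A)
    {z : AnnulusCover} (hz : z ∈ A) :
    ∃ n : ℕ, n ≠ 0 ∧ ∃ l : ℤ, deck ^ l * ft ^ n ∈ homeomorphStab (connectedComponentIn A z) := by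
  obtain ⟨n, hn, x, hx, y, hy, l, hxy⟩ := hlift.exists_recurrence harea
    (hAo.connectedComponentIn (x := z)) ⟨z, mem_connectedComponentIn hz⟩
  refine ⟨n, hn, -l, mem_homeomorphStab_iff_image.2 (image_connectedComponentIn_eq _
    (mem_homeomorphStab.1 (mul_mem (zpow_mem hAd _) (pow_mem hA _))) hx ?_)⟩
  rw [Homeomorph.mul_apply, hxy, ← Homeomorph.mul_apply, ← zpow_add, neg_add_cancel, zpow_zero]
  exact hy

/-- Components of the lift of an invariant open set are periodic under the deck group. -/
theorem IsLift.exists_deck_zpow_mem_stab {f : Annulus ≃ₜ Annulus}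
    {ft : AnnulusCover ≃ₜ AnnulusCover}
    (hlift : IsLift f ft) (harea : MeasurePreserving f volume volume) (hnicis : NICIS f)
    {A : Set AnnulusCover} (hAo : IsOpen A) (hAi : A ⊆ coverInt) (hA : ft ∈ homeomorphStab A)
    (hAd : deck ∈ homeomorphStab A) {z : AnnulusCover} (hz : z ∈ A) :
    ∃ k : ℤ, 0 < k ∧ deck ^ k ∈ homeomorphStab (connectedComponentIn A z) := by
  by_contra! hcon
  have hdisj : ∀ l : ℤ, ∀ y ∈ connectedComponentIn A z,
      (deck ^ l) y ∈ connectedComponentIn A z → l = 0 := by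
    intro l y hy hly
    have h := mem_homeomorphStab_iff_image.2 (image_connectedComponentIn_eq _
      (mem_homeomorphStab.1 (zpow_mem hAd l)) hy hly)
    rcases lt_trichotomy l 0 with h1 | h1 | h1
    · exact absurd (by simpa using inv_mem h) (hcon (-l) (by omega))
    · exact h1
    · exact absurd h (hcon l h1)
  obtain ⟨n, hn, l, hg⟩ := hlift.exists_return harea hAo hA hAd hz
  set g := deck ^ l * ft ^ n with hgdef
  have hgl : IsLift (f ^ n) g := (hlift.pow n).deck_zpow_mul l
  obtain ⟨D, hD, hzD, hDw⟩ := exists_wandering_nhd_strip g (fun w hw hfix => by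
    refine hnicis.pow hlift.mem_annulusInt_iff (n := n * 2) (by omega)
      ⟨{annulusProj w}, ⟨_, rfl⟩, isCompact_singleton, ?_, ?_⟩
    · rw [image_singleton, pow_mul, pow_two, (hgl.mul hgl).2]
      exact congr_arg (fun u => {annulusProj u}) hfix
    · rw [singleton_subset_iff]; exact hw) (hAi hz)
  obtain ⟨m, hm, x, ⟨hxD, hxC⟩, y, ⟨hyD, hyC⟩, j, hxy⟩ := (hgl.mul hgl).exists_recurrence
    (by
      rw [← pow_two]
      exact measurePreserving_pow (measurePreserving_pow harea n) 2)
    (hD.inter (hAo.connectedComponentIn (x := z))) ⟨z, hzD, mem_connectedComponentIn hz⟩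
  have h1 := (mem_homeomorphStab.1 (pow_mem (mul_mem hg hg) m) x).2 hxC
  rw [hxy] at h1
  have hj := hdisj j y hyC h1
  rw [hj, zpow_zero] at hxy
  exact hDw m (by omega) x hxD (by rw [hxy]; exact hyD)

/-- A periodic connected open set separates the two ends of the strip. -/
theorem exists_barrier {W : Set AnnulusCover} (hWo : IsOpen W) (hWc : IsConnected W)
    (hWi : W ⊆ coverInt) {k : ℤ} (hk : 0 < k) (hkW : deck ^ k ∈ homeomorphStab W) :
    ∃ ε : ℝ, 0 < ε ∧ ∀ P : Set AnnulusCover, IsPathConnected P → (∃ p ∈ P, (p.2 : ℝ) ≤ -1 + ε) →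
      (∃ q ∈ P, 1 - ε ≤ (q.2 : ℝ)) → (P ∩ W).Nonempty := by
  obtain ⟨z, hz⟩ := hWc.nonempty
  obtain ⟨β, hβ⟩ := (hWo.isConnected_iff_isPathConnected.1 hWc).joinedIn z hz ((deck ^ k) z)
    ((hkW z).2 hz)
  obtain ⟨t₀, -, ht₀⟩ := isCompact_univ.exists_isMinOn (univ_nonempty (α := unitInterval))
    (f := fun t => min (1 + ((β t).2 : ℝ)) (1 - (β t).2)) (by fun_prop)
  set m := min (1 + ((β t₀).2 : ℝ)) (1 - (β t₀).2) with hm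
  have hm0 : 0 < m := lt_min (by linarith [(hWi (hβ t₀)).1]) (by linarith [(hWi (hβ t₀)).2])
  have hβm : ∀ t, -1 + m / 2 < ((β t).2 : ℝ) ∧ ((β t).2 : ℝ) < 1 - m / 2 := by
    intro t
    have h : m ≤ min (1 + ((β t).2 : ℝ)) (1 - (β t).2) := ht₀ (mem_univ t)
    have := le_min_iff.1 h
    constructor <;> linarith
  have hext : ∀ {a b : AnnulusCover} (p : Path a b) (t : ℝ), ∃ u, p.extend t = p u :=
    fun p t => ⟨_, rfl⟩
  set γ : ℝ → AnnulusCover := fun s => ((deck ^ k) ^ ⌊s⌋) (β.extend (Int.fract s)) with hγ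
  have hγc : Continuous γ := continuous_zpow_floor_fract _ β.continuous_extend (by simp)
  have hγW : ∀ s, γ s ∈ W := by
    intro s
    obtain ⟨u, hu⟩ := hext β (Int.fract s)
    exact (mem_homeomorphStab.1 (zpow_mem hkW ⌊s⌋) _).2 (hu ▸ hβ u)
  have hγy : ∀ s, -1 + m / 2 < ((γ s).2 : ℝ) ∧ ((γ s).2 : ℝ) < 1 - m / 2 := by
    intro s
    obtain ⟨u, hu⟩ := hext β (Int.fract s)
    simp only [hγ, ← zpow_mul, deck_zpow_apply, hu]
    exact hβm u
  have hγn : ∀ n : ℤ, (γ n).1 = z.1 + k * n := by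
    intro n
    simp [hγ, ← zpow_mul, deck_zpow_apply]
  refine ⟨m / 2, by linarith, ?_⟩
  rintro P hP ⟨p, hp, hpy⟩ ⟨q, hq, hqy⟩
  obtain ⟨δ, hδ⟩ := hP.joinedIn p hp q hq
  obtain ⟨s₀, -, hs₀⟩ := isCompact_univ.exists_isMaxOn (univ_nonempty (α := unitInterval))
    (f := fun t => |(δ t).1|) (by fun_prop)
  obtain ⟨N, hN⟩ := exists_nat_gt (|(δ s₀).1| + |z.1|)
  have hkN : (N : ℝ) ≤ k * N := by
    have : (1 : ℝ) ≤ k := by exact_mod_cast hk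
    nlinarith [(Nat.cast_nonneg N : (0 : ℝ) ≤ N)]
  have hδN : ∀ s, |(δ.extend s).1| + |z.1| < k * N := by
    intro s
    obtain ⟨u, hu⟩ := hext δ s
    have : |(δ u).1| ≤ |(δ s₀).1| := hs₀ (mem_univ u)
    rw [hu]
    linarith
  have e0 : γ (N * (2 * 0 - 1)) = γ ((-N : ℤ) : ℝ) := by congr 1; push_cast; ring
  have e1 : γ (N * (2 * 1 - 1)) = γ ((N : ℤ) : ℝ) := by congr 1; push_cast; ring
  obtain ⟨s, t, hst⟩ := exists_crossing (γ := fun t => coverCoord (γ (N * (2 * t - 1))))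
    (δ := fun s => coverCoord (δ.extend s))
    (continuous_coverCoord.comp (hγc.comp (by fun_prop)))
    (continuous_coverCoord.comp δ.continuous_extend)
    (fun s => by
      simp only [coverCoord, e0, hγn]
      push_cast
      linarith [hδN s, neg_abs_le (δ.extend s).1, le_abs_self z.1])
    (fun s => by
      simp only [coverCoord, e1, hγn]
      push_cast
      linarith [hδN s, le_abs_self (δ.extend s).1, neg_abs_le z.1])
    (fun t => by
      simp only [coverCoord, Path.extend_zero]
      linarith [(hγy (N * (2 * t - 1))).1])
    (fun t => by
      simp only [coverCoord, Path.extend_one]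
      linarith [(hγy (N * (2 * t - 1))).2])
  obtain ⟨u, hu⟩ := hext δ s
  refine ⟨δ.extend s, hu ▸ hδ u, ?_⟩
  rw [injective_coverCoord hst]
  exact hγW _

section Stab

variable {Y : Type*} [TopologicalSpace Y] {A : Set Y} {F : Y ≃ₜ Y}

theorem homeomorphStab_compl (h : F ∈ homeomorphStab A) : F ∈ homeomorphStab Aᶜ :=
  fun y => not_congr (h y)

theorem homeomorphStab_closure (h : F ∈ homeomorphStab A) : F ∈ homeomorphStab (closure A) := by
  rw [mem_homeomorphStab_iff_image] at h ⊢
  rw [F.image_closure, h]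

theorem homeomorphStab_frontier (h : F ∈ homeomorphStab A) : F ∈ homeomorphStab (frontier A) := by
  rw [mem_homeomorphStab_iff_image] at h ⊢
  rw [F.image_frontier, h]

end Stab

theorem eq_neg_one_or_one_of_notMem_coverInt {p : AnnulusCover} (hp : p ∉ coverInt) :
    (p.2 : ℝ) = -1 ∨ (p.2 : ℝ) = 1 := by
  by_contra! hcon
  exact hp ⟨lt_of_le_of_ne p.2.2.1 hcon.1.symm, lt_of_le_of_ne p.2.2.2 hcon.2⟩

/-- The square of a homeomorphism of the strip preserves each boundary line. -/
theorem homeomorph_sq_snd_of_notMem_coverInt (F : AnnulusCover ≃ₜ AnnulusCover) {p : AnnulusCover}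
    (hp : p ∉ coverInt) : (F (F p)).2 = p.2 := by
  have hF : ∀ q, q ∉ coverInt → F q ∉ coverInt := fun q hq h => hq ((mem_coverInt_iff F).1 h)
  have hconst : ∀ q r : AnnulusCover, q ∉ coverInt → q.2 = r.2 →
      ((F q).2 : ℝ) ≤ (F r).2 := by
    rintro ⟨x, y⟩ ⟨x', y'⟩ hq (rfl : y = y')
    have hbd : ∀ u : ℝ, ((u, y) : AnnulusCover) ∉ coverInt := fun u => hq
    by_contra! hlt
    obtain ⟨u, hu⟩ := mem_range_of_exists_le_of_exists_ge (c := (0 : ℝ))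
      (f := fun u : ℝ => ((F (u, y)).2 : ℝ)) (by fun_prop)
      ⟨x', by
        rcases eq_neg_one_or_one_of_notMem_coverInt (hF _ (hbd x)) with h | h <;>
        rcases eq_neg_one_or_one_of_notMem_coverInt (hF _ (hbd x')) with h' | h' <;> linarith⟩
      ⟨x, by
        rcases eq_neg_one_or_one_of_notMem_coverInt (hF _ (hbd x)) with h | h <;>
        rcases eq_neg_one_or_one_of_notMem_coverInt (hF _ (hbd x')) with h' | h' <;> linarith⟩
    exact hF _ (hbd u) ⟨by simp only [hu]; norm_num, by simp only [hu]; norm_num⟩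
  have hconst' : ∀ q r : AnnulusCover, q ∉ coverInt → q.2 = r.2 → (F q).2 = (F r).2 :=
    fun q r hq hqr => Subtype.ext (le_antisymm (hconst q r hq hqr)
      (hconst r q (by rintro ⟨h1, h2⟩; exact hq ⟨by rw [hqr]; exact h1, by rw [hqr]; exact h2⟩)
        hqr.symm))
  by_contra hne
  have htwo : ∀ a b c : AnnulusCover, a ∉ coverInt → b ∉ coverInt → c ∉ coverInt →
      a.2 ≠ b.2 → c.2 = a.2 ∨ c.2 = b.2 := by
    intro a b c ha hb hc hab
    rw [Ne, ← Subtype.coe_inj] at hab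
    rw [← Subtype.coe_inj, ← Subtype.coe_inj]
    rcases eq_neg_one_or_one_of_notMem_coverInt ha with h | h <;>
    rcases eq_neg_one_or_one_of_notMem_coverInt hb with h' | h' <;>
    rcases eq_neg_one_or_one_of_notMem_coverInt hc with h'' | h'' <;>
    first
    | exact absurd (h.trans h'.symm) hab
    | exact Or.inl (h''.trans h.symm)
    | exact Or.inr (h''.trans h'.symm)
  have h1 : (F p).2 ≠ p.2 := fun h => hne ((hconst' _ _ (hF p hp) h).trans h)
  have h2 : (F (F p)).2 = (F p).2 :=
    (htwo _ _ _ (hF p hp) hp (hF _ (hF p hp)) h1).resolve_right hne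
  have hq : F.symm p ∉ coverInt := fun h => hp (by simpa using mapsTo_coverInt F h)
  rcases htwo _ _ _ (hF p hp) hp hq h1 with h | h
  · have := hconst' _ _ hq h
    rw [F.apply_symm_apply, h2] at this
    exact h1 this.symm
  · have := hconst' _ _ hq h
    rw [F.apply_symm_apply] at this
    exact h1 this.symm

theorem isCompact_image_annulusProj {K : Set AnnulusCover} (hK : IsClosed K)
    (hd : deck ∈ homeomorphStab K) : IsCompact (annulusProj '' K) := by
  have hc : IsCompact (K ∩ (Icc (0 : ℝ) 1 ×ˢ univ)) :=
    (isCompact_Icc.prod isCompact_univ).inter_left hK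
  convert hc.image continuous_annulusProj using 1
  refine Subset.antisymm ?_ (image_mono inter_subset_left)
  rintro _ ⟨p, hp, rfl⟩
  refine ⟨(deck ^ (-⌊p.1⌋)) p, ⟨(mem_homeomorphStab.1 (zpow_mem hd _) p).2 hp, ?_, mem_univ _⟩,
    annulusProj_deck_zpow _ _⟩
  simp only [deck_zpow_apply, Int.cast_neg, mem_Icc]
  constructor <;> linarith [Int.floor_le p.1, Int.lt_floor_add_one p.1]

theorem isPreconnected_half_strip (σ c : ℝ) :
    IsPreconnected {p : AnnulusCover | c < σ * p.2} := by
  have hconv : Convex ℝ ({p : ℝ × ℝ | c < σ * p.2} ∩ {p | p.2 ∈ Icc (-1 : ℝ) 1}) := by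
    refine Convex.inter ?_ ?_
    · exact convex_halfSpace_gt (IsLinearMap.mk (by intros; simp; ring) (by intros; simp; ring)) c
    · exact (convex_Icc _ _).is_linear_preimage (IsLinearMap.mk (by simp) (by simp))
  convert hconv.isPreconnected.image _ continuous_coverRetract.continuousOn using 1
  ext p
  constructor
  · intro hp
    exact ⟨(p.1, (p.2 : ℝ)), ⟨hp, p.2.2⟩, by simp [coverRetract]⟩
  · rintro ⟨q, ⟨hq, hq'⟩, rfl⟩
    rw [mem_ofPred_eq, coverRetract_snd hq']
    exact hq

/-- A component of the lift of an invariant open set is not bounded away from a boundary line. -/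
theorem IsLift.component_not_one_sided {f : Annulus ≃ₜ Annulus} {ft : AnnulusCover ≃ₜ AnnulusCover}
    (hlift : IsLift f ft) (harea : MeasurePreserving f volume volume) (hnicis : NICIS f)
    {A : Set AnnulusCover} (hAo : IsOpen A) (hAi : A ⊆ coverInt) (hA : ft ∈ homeomorphStab A)
    (hAd : deck ∈ homeomorphStab A) {z : AnnulusCover} (hz : z ∈ A) {σ : ℝ} (hσ : σ = 1 ∨ σ = -1)
    {η : ℝ} (hη : 0 < η) (hC : ∀ p ∈ connectedComponentIn A z, σ * p.2 < 1 - η) : False := by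
  set C := connectedComponentIn A z with hCdef
  have hCo : IsOpen C := hAo.connectedComponentIn
  have hzC : z ∈ C := mem_connectedComponentIn hz
  have hCc : IsConnected C := ⟨⟨z, hzC⟩, isPreconnected_connectedComponentIn⟩
  have hCi : C ⊆ coverInt := (connectedComponentIn_subset _ _).trans hAi
  obtain ⟨k, hk, hkC⟩ := hlift.exists_deck_zpow_mem_stab harea hnicis hAo hAi hA hAd hz
  obtain ⟨ε, hε, hbar⟩ := exists_barrier hCo hCc hCi hk hkC
  obtain ⟨n, hn, l, hg⟩ := hlift.exists_return harea hAo hA hAd hz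
  set g := deck ^ l * ft ^ n with hgdef
  have hgl : IsLift (f ^ n) g := (hlift.pow n).deck_zpow_mul l
  set Z : Set AnnulusCover := {y | ∃ j : ℤ, (deck ^ j) y ∈ C} with hZ
  have hCZ : C ⊆ Z := fun y hy => ⟨0, hy⟩
  have hgZ : g ∈ homeomorphStab Z := by
    intro y
    refine exists_congr fun j => ?_
    rw [← Homeomorph.mul_apply, ← (hgl.commute.zpow_right j).eq]
    exact hg _
  have hdZ : deck ∈ homeomorphStab Z := by
    intro y
    constructor
    · rintro ⟨j, hj⟩
      exact ⟨j + 1, by rw [zpow_add_one]; exact hj⟩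
    · rintro ⟨j, hj⟩
      refine ⟨j - 1, ?_⟩
      rw [← Homeomorph.mul_apply, ← zpow_add_one, sub_add_cancel]
      exact hj
  have hZle : closure Z ⊆ {p | σ * p.2 ≤ 1 - η} := by
    refine closure_minimal ?_ (isClosed_le (by fun_prop) continuous_const)
    rintro p ⟨j, hj⟩
    have := hC _ hj
    rw [deck_zpow_apply] at this
    exact this.le
  set B := (closure Z)ᶜ with hB
  have hBo : IsOpen B := isClosed_closure.isOpen_compl
  have hgB : g ∈ homeomorphStab B := homeomorphStab_compl (homeomorphStab_closure hgZ)
  have hdB : deck ∈ homeomorphStab B := homeomorphStab_compl (homeomorphStab_closure hdZ)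
  set L : Set AnnulusCover := {p | 1 - η < σ * p.2} with hL
  have hLB : L ⊆ B := fun p hp hpZ =>
    not_lt.2 (show σ * (p.2 : ℝ) ≤ 1 - η from hZle hpZ) hp
  have hσσ : σ * σ = 1 := by rcases hσ with rfl | rfl <;> norm_num
  obtain ⟨t, ht⟩ : ∃ t : AnnulusCover, (t.2 : ℝ) = σ :=
    ⟨(0, ⟨σ, by rcases hσ with rfl | rfl <;> norm_num⟩), rfl⟩
  have htL : ∀ q : AnnulusCover, q.2 = t.2 → q ∈ L := by
    intro q hq
    rw [hL, mem_ofPred_eq, hq, ht, hσσ]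
    linarith
  have hti : t ∉ coverInt := by
    rintro ⟨h1, h2⟩
    rcases hσ with rfl | rfl <;> linarith
  set O := connectedComponentIn B t with hO
  have hLO : L ⊆ O :=
    (isPreconnected_half_strip σ (1 - η)).subset_connectedComponentIn (htL t rfl) hLB
  have hOo : IsOpen O := hBo.connectedComponentIn
  have htO : t ∈ O := hLO (htL t rfl)
  have hOp : IsPathConnected O := hOo.isConnected_iff_isPathConnected.1
    ⟨⟨t, htO⟩, isPreconnected_connectedComponentIn⟩
  have hOC : ∀ p ∈ O, p ∉ C := fun p hp hpC =>
    connectedComponentIn_subset _ _ hp (subset_closure (hCZ hpC))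
  have hOge : ∀ p ∈ O, -1 + ε ≤ σ * p.2 := by
    intro p hp
    by_contra! hlt
    suffices (O ∩ C).Nonempty from this.elim fun q hq => hOC q hq.1 hq.2
    rcases hσ with rfl | rfl
    · exact hbar O hOp ⟨p, hp, by linarith⟩ ⟨t, htO, by linarith⟩
    · exact hbar O hOp ⟨t, htO, by linarith⟩ ⟨p, hp, by linarith⟩
  have hdO : deck ∈ homeomorphStab O := mem_homeomorphStab_iff_image.2
    (image_connectedComponentIn_eq _ hdB htO (hLO (htL _ rfl)))
  have hgO : g * g ∈ homeomorphStab O := mem_homeomorphStab_iff_image.2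
    (image_connectedComponentIn_eq _ (mem_homeomorphStab.1 (mul_mem hgB hgB)) htO
      (hLO (htL _ (homeomorph_sq_snd_of_notMem_coverInt g hti))))
  have hge : frontier O ⊆ {p | -1 + ε ≤ σ * p.2} := frontier_subset_closure.trans
    (closure_minimal hOge (isClosed_le continuous_const (by fun_prop)))
  have hle : frontier O ⊆ {p | σ * p.2 ≤ 1 - η} := by
    intro p hp
    by_contra hlt
    rw [hOo.frontier_eq] at hp
    exact hp.2 (hLO (show 1 - η < σ * (p.2 : ℝ) from not_le.1 hlt))
  have : PreconnectedSpace (Icc (-1 : ℝ) 1) := Subtype.preconnectedSpace isPreconnected_Icc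
  have hnon : (frontier O).Nonempty :=
    nonempty_frontier_iff.2 ⟨⟨t, htO⟩, fun h => hOC z (h ▸ mem_univ z) hzC⟩
  refine hnicis.pow hlift.mem_annulusInt_iff (n := n * 2) (by omega)
    ⟨annulusProj '' frontier O, hnon.image _,
      isCompact_image_annulusProj isClosed_frontier (homeomorphStab_frontier hdO), ?_, ?_⟩
  · rw [pow_mul, pow_two]
    conv_rhs => rw [← mem_homeomorphStab_iff_image.1 (homeomorphStab_frontier hgO)]
    rw [image_image, image_image]
    exact image_congr fun p _ => (hgl.mul hgl).2 p
  · rintro _ ⟨p, hp, rfl⟩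
    have h1 : -1 + ε ≤ σ * p.2 := hge hp
    have h2 : σ * p.2 ≤ 1 - η := hle hp
    change -1 < (p.2 : ℝ) ∧ (p.2 : ℝ) < 1
    rcases hσ with rfl | rfl <;> constructor <;> linarith

/-- Two nonempty invariant open subsets of the open annulus meet. -/
theorem IsLift.inter_nonempty_of_invariant {f : Annulus ≃ₜ Annulus}
    {ft : AnnulusCover ≃ₜ AnnulusCover}
    (hlift : IsLift f ft) (harea : MeasurePreserving f volume volume) (hnicis : NICIS f)
    {U V : Set Annulus} (hUo : IsOpen U) (hVo : IsOpen V) (hUi : U ⊆ annulusInt)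
    (hVi : V ⊆ annulusInt) (hU : f ∈ homeomorphStab U) (hV : f ∈ homeomorphStab V)
    (hUn : U.Nonempty) (hVn : V.Nonempty) : (U ∩ V).Nonempty := by
  by_contra hdisj
  have hft : ∀ {U}, f ∈ homeomorphStab U → ft ∈ homeomorphStab (annulusProj ⁻¹' U) := by
    intro U hU y
    rw [mem_preimage, ← hlift.2]
    exact hU _
  have hdeck : ∀ U, deck ∈ homeomorphStab (annulusProj ⁻¹' U) := by
    intro U y
    have := annulusProj_deck_zpow 1 y
    rw [zpow_one] at this
    rw [mem_preimage, this, mem_preimage]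
  have hUo' := hUo.preimage continuous_annulusProj
  have hVo' := hVo.preimage continuous_annulusProj
  obtain ⟨z, hz⟩ := surjective_annulusProj.nonempty_preimage.2 hUn
  obtain ⟨w, hw⟩ := surjective_annulusProj.nonempty_preimage.2 hVn
  have hVi' : annulusProj ⁻¹' V ⊆ coverInt := fun y hy => hVi hy
  have hUi' : annulusProj ⁻¹' U ⊆ coverInt := fun y hy => hUi hy
  obtain ⟨k, hk, hkC⟩ := hlift.exists_deck_zpow_mem_stab harea hnicis hVo' hVi' (hft hV)
    (hdeck V) hw
  obtain ⟨η, hη, hbar⟩ := exists_barrier hVo'.connectedComponentIn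
    ⟨⟨w, mem_connectedComponentIn hw⟩, isPreconnected_connectedComponentIn⟩
    ((connectedComponentIn_subset _ _).trans hVi') hk hkC
  have hpath : IsPathConnected (connectedComponentIn (annulusProj ⁻¹' U) z) :=
    hUo'.connectedComponentIn.isConnected_iff_isPathConnected.1
      ⟨⟨z, mem_connectedComponentIn hz⟩, isPreconnected_connectedComponentIn⟩
  have hnot := fun {σ : ℝ} (hσ : σ = 1 ∨ σ = -1) =>
    hlift.component_not_one_sided harea hnicis hUo' hUi' (hft hU) (hdeck U) hz hσ hη
  by_cases hlow : ∃ p ∈ connectedComponentIn (annulusProj ⁻¹' U) z, (p.2 : ℝ) ≤ -1 + η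
  · refine hnot (Or.inl rfl) fun q hq => ?_
    by_contra! hlt
    obtain ⟨u, hu1, hu2⟩ := hbar _ hpath hlow ⟨q, hq, by linarith⟩
    exact hdisj ⟨annulusProj u, connectedComponentIn_subset (annulusProj ⁻¹' U) _ hu1,
      connectedComponentIn_subset (annulusProj ⁻¹' V) _ hu2⟩
  · push Not at hlow
    exact hnot (Or.inr rfl) fun q hq => by linarith [hlow q hq]

theorem dense_annulusInt : Dense annulusInt := by
  rintro ⟨x, y⟩
  have hle : (-1 : ℝ) ≤ 1 := by norm_num
  let φ : ℝ → Annulus := fun t => (x, projIcc (-1) 1 hle (t * y))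
  have hφ : Continuous φ :=
    continuous_const.prodMk (continuous_projIcc.comp (by fun_prop))
  have h1 : φ 1 = (x, y) := by simp [φ]
  have hcl : (1 : ℝ) ∈ closure (Ioo (0 : ℝ) 1) := by
    rw [closure_Ioo (by norm_num)]; norm_num
  rw [← h1]
  refine closure_mono ?_ (image_closure_subset_closure_image hφ ⟨1, hcl, rfl⟩)
  rintro _ ⟨t, ht, rfl⟩
  have hy1 := y.2.1
  have hy2 := y.2.2
  have hlo : -1 < t * y := by nlinarith [ht.1, ht.2]
  have hhi : t * y < 1 := by nlinarith [ht.1, ht.2]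
  change -1 < ((projIcc (-1) 1 hle (t * y) : Icc (-1 : ℝ) 1) : ℝ) ∧
    ((projIcc (-1) 1 hle (t * y) : Icc (-1 : ℝ) 1) : ℝ) < 1
  rw [projIcc_of_mem _ ⟨hlo.le, hhi.le⟩]
  exact ⟨hlo, hhi⟩

theorem toEquiv_zpow_apply {Y : Type*} [TopologicalSpace Y] (f : Y ≃ₜ Y) (n : ℤ) (y : Y) :
    (f.toEquiv ^ n) y = (f ^ n) y := by
  let φ : (Y ≃ₜ Y) →* Equiv.Perm Y :=
    { toFun := Homeomorph.toEquiv, map_one' := rfl, map_mul' := fun _ _ => rfl }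
  exact congr_arg (fun e : Equiv.Perm Y => e y) (map_zpow φ f n).symm

/-- A NICIS homeomorphism admits a dense orbit. -/
theorem stmt_3 (f : Annulus ≃ₜ Annulus) (ft : AnnulusCover ≃ₜ AnnulusCover)
    (harea : MeasurePreserving f volume volume)
    (hlift : IsLift f ft) (hnicis : NICIS f) :
    ∃ z ∈ annulusInt, Dense (Set.range fun n : ℤ => (f.toEquiv ^ n) z) := by
  simp only [toEquiv_zpow_apply]
  set O : Set Annulus → Set Annulus := fun V => {z | ∃ n : ℤ, (f ^ n) z ∈ V} with hO
  have hOo : ∀ V, IsOpen V → IsOpen (O V) := by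
    intro V hV
    rw [show O V = ⋃ n : ℤ, (f ^ n : Annulus ≃ₜ Annulus) ⁻¹' V by ext; simp [hO]]
    exact isOpen_iUnion fun n => hV.preimage (f ^ n).continuous
  have hOf : ∀ V, f ∈ homeomorphStab (O V) := by
    intro V z
    constructor
    · rintro ⟨n, hn⟩
      exact ⟨n + 1, by rw [zpow_add_one]; exact hn⟩
    · rintro ⟨n, hn⟩
      refine ⟨n - 1, ?_⟩
      rw [← Homeomorph.mul_apply, ← zpow_add_one, sub_add_cancel]
      exact hn
  have hOi : ∀ V, O (V ∩ annulusInt) ⊆ annulusInt := by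
    rintro V z ⟨n, -, hn⟩
    exact (zpow_mem (show f ∈ homeomorphStab annulusInt from hlift.mem_annulusInt_iff) n z).1 hn
  have hsub : ∀ V, V ⊆ O V := fun V z hz => ⟨0, hz⟩
  have hne : ∀ V, IsOpen V → V.Nonempty → (O (V ∩ annulusInt)).Nonempty := fun V hV hVn =>
    (dense_annulusInt.inter_open_nonempty V hV hVn).mono (hsub _)
  have hdense : ∀ V, IsOpen V → V.Nonempty → Dense (O V) := by
    intro V hV hVn
    rw [dense_iff_inter_open]
    intro V' hV' hVn'
    obtain ⟨z, ⟨n, hn, -⟩, ⟨m, hm, -⟩⟩ := hlift.inter_nonempty_of_invariant harea hnicis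
      (hOo _ (hV.inter isOpen_annulusInt)) (hOo _ (hV'.inter isOpen_annulusInt)) (hOi V) (hOi V')
      (hOf _) (hOf _) (hne V hV hVn) (hne V' hV' hVn')
    refine ⟨(f ^ m) z, hm, n - m, ?_⟩
    rw [← Homeomorph.mul_apply, ← zpow_add, sub_add_cancel]
    exact hn
  have hbasis := TopologicalSpace.isBasis_countableBasis Annulus
  have hbaire : Dense (⋂ V ∈ TopologicalSpace.countableBasis Annulus, O V) :=
    dense_biInter_of_isOpen (fun V hV => hOo V (hbasis.isOpen hV))
      (TopologicalSpace.countable_countableBasis Annulus) fun V hV =>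
      hdense V (hbasis.isOpen hV) (TopologicalSpace.nonempty_of_mem_countableBasis hV)
  have hn : annulusInt.Nonempty := ⟨(0, ⟨0, by norm_num⟩), by simp [annulusInt]⟩
  obtain ⟨z, hzi, hz⟩ := hbaire.inter_open_nonempty _ isOpen_annulusInt hn
  refine ⟨z, hzi, hbasis.dense_iff.2 fun V hV _ => ?_⟩
  obtain ⟨n, hn⟩ := mem_iInter₂.1 hz V hV
  exact ⟨_, hn, n, rfl⟩
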